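/- Let W be an admissible Wilson loop diagram with k propagators and n vertices. The sequence of k-subsets (I_1^W, ..., I_n^W) obtained by applying the Grassmann necklace algorithm at every starting vertex of W is a Grassmann necklace of type (k,n). -/

import Mathlib

open scoped Classical

namespace WLD

/-- A propagator of a Wilson loop diagram on the cyclically ordered vertex set
`ZMod n` (vertex `n` is identified with `0`): an unordered pair of edges, the
edge joining vertex `i` to vertex `i+1` being labelled `i`. -/
abbrev Prp (n : ℕ) := Sym2 (ZMod n)

variable (n : ℕ)

/-- The position of `x` in the linear order `i <_i i+1 <_i ⋯ <_i i-1`. -/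
def ord (i x : ZMod n) : ℕ := (x - i).val

/-- The other end of a propagator `p` having an end on the edge `e`. -/
noncomputable def otherEnd (p : Prp n) (e : ZMod n) : ZMod n :=
  if h : e ∈ p then Sym2.Mem.other h else e

/-- The vertex support `V(p) = {i, i+1, j, j+1}` of the propagator `p = (i,j)`. -/
def supp (p : Prp n) : Finset (ZMod n) :=
  Sym2.lift ⟨fun i j => {i, i + 1, j, j + 1}, fun i j => by
    ext x
    simp only [Finset.mem_insert, Finset.mem_singleton]
    tauto⟩ p

/-- The vertex support `V(Q)` of a set of propagators. -/
def suppSet (Q : Finset (Prp n)) : Finset (ZMod n) := Q.biUnion (supp n)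

/-- `Prop(U)`: the propagators of `P` supported on (a vertex of) `U`. -/
noncomputable def propsOn (P : Finset (Prp n)) (U : Finset (ZMod n)) : Finset (Prp n) :=
  P.filter fun p => (supp n p ∩ U).Nonempty

/-- Two propagators `p = (i,j)` and `q = (k,l)` cross if `i < k < j < l` cyclically. -/
def Crossing (p q : Prp n) : Prop :=
  ∃ i j k l : ZMod n, p = s(i, j) ∧ q = s(k, l) ∧
    0 < ord n i k ∧ ord n i k < ord n i j ∧ ord n i j < ord n i l

/-- Weak admissibility of a Wilson loop diagram. -/
structure IsWeaklyAdmissible (P : Finset (Prp n)) : Prop where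
  dense : ∀ Q ⊆ P, Q.Nonempty → Q.card + 3 ≤ (suppSet n Q).card
  noncross : ∀ p ∈ P, ∀ q ∈ P, ¬ Crossing n p q

/-- Admissibility of a Wilson loop diagram. -/
structure IsAdmissible (P : Finset (Prp n)) : Prop where
  card_add_four_le : P.card + 4 ≤ n
  dense : ∀ Q ⊆ P, Q.Nonempty → Q.card + 3 ≤ (suppSet n Q).card
  noncross : ∀ p ∈ P, ∀ q ∈ P, ¬ Crossing n p q

/-- The length of a propagator `p = (i,j)`:
`min(|[i+1, j]|, |[j+1, i]|)`, the number of vertices on its smaller side. -/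
def plength (p : Prp n) : ℕ :=
  Sym2.lift ⟨fun i j => min ((j - i - 1).val + 1) ((i - j - 1).val + 1),
    fun _ _ => min_comm _ _⟩ p

/-- `InsideDir n i p q` : the propagator `q = (k,l)` lies (weakly) inside the
propagator `p = (i,j)` directed from its end `i`, i.e. `i ≤_i k <_i l ≤_i j`. -/
def InsideDir (i : ZMod n) (p q : Prp n) : Prop :=
  ∃ j k l : ZMod n, p = s(i, j) ∧ q = s(k, l) ∧
    ord n i k < ord n i l ∧ ord n i l ≤ ord n i j

/-- Sorting key measuring how far clockwise of the vertex `a` the relevant end of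
a propagator supported on `a` is attached: ends on the edge `a-1` are clockwise of
ends on the edge `a`, and on a fixed edge an end is the more clockwise the larger
the propagator is (nestedness of noncrossing propagators sharing an edge). -/
noncomputable def cwKey (a : ZMod n) (p : Prp n) : ℕ :=
  if a - 1 ∈ p then n + ord n (a - 1) (otherEnd n p (a - 1))
  else ord n a (otherEnd n p a)

/-- The clockwise-most propagator of `S` supported on the vertex `a`, if any. -/
noncomputable def pickCW (S : Finset (Prp n)) (a : ZMod n) : Option (Prp n) :=
  if h : (S.filter fun p => a ∈ supp n p).Nonempty then
    some (Classical.choose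
      ((S.filter fun p => a ∈ supp n p).exists_max_image (cwKey n a) h))
  else none

/-- The Grassmann necklace algorithm started at the vertex `i`: after `t` steps,
`(gnRun n P i t).1` is the set of propagators not yet deleted, and
`(gnRun n P i t).2` records the vertex assigned to each deleted propagator.
Step `t+1` processes the vertex `i + t`: if some not-yet-deleted propagator is
supported on it, the clockwise-most such propagator is deleted and assigned
that vertex. -/
noncomputable def gnRun (P : Finset (Prp n)) (i : ZMod n) :
    ℕ → Finset (Prp n) × (Prp n → Option (ZMod n))
  | 0 => (P, fun _ => none)
  | t + 1 =>
    match pickCW n (gnRun P i t).1 (i + (t : ZMod n)) with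
    | none => gnRun P i t
    | some p => ((gnRun P i t).1.erase p,
        Function.update (gnRun P i t).2 p (some (i + (t : ZMod n))))

/-- `I_i^W(p)`: the vertex contributed by the propagator `p` to the Grassmann
necklace term `I_i^W` (as an `Option`; the algorithm makes one full circuit of
the vertex set, i.e. runs for `n` steps). -/
noncomputable def gnAssign (P : Finset (Prp n)) (i : ZMod n) (p : Prp n) :
    Option (ZMod n) :=
  (gnRun n P i n).2 p

/-- The Grassmann necklace term `I_i^W` produced by the algorithm. -/
noncomputable def gnSet [NeZero n] (P : Finset (Prp n)) (i : ZMod n) :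
    Finset (ZMod n) :=
  Finset.univ.filter fun v => ∃ p, gnAssign n P i p = some v

/-- The cyclic interval `{a, a+1, …, a + (len-1)}` in `ZMod n`. -/
def cInterval [NeZero n] (a : ZMod n) (len : ℕ) : Finset (ZMod n) :=
  Finset.univ.filter fun x => ord n a x < len

/-- A Grassmann necklace of type `(k, n)`: a cyclic sequence of `k`-element
subsets of the vertex set such that `I_{i+1} = (I_i \ {i}) ∪ {j}` for some `j`
whenever `i ∈ I_i`, and `I_{i+1} = I_i` otherwise. -/
def IsGrassmannNecklace [NeZero n] (k : ℕ) (I : ZMod n → Finset (ZMod n)) : Prop :=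
  (∀ i, (I i).card = k) ∧
  ∀ i : ZMod n,
    (i ∈ I i → ∃ j : ZMod n, I (i + 1) = insert j ((I i).erase i)) ∧
    (i ∉ I i → I (i + 1) = I i)

/-- Independence in the matroid `M(W)`: no subset `U` of `J` supports fewer
propagators than the vertices it contains. -/
def Indep (P : Finset (Prp n)) (J : Finset (ZMod n)) : Prop :=
  ∀ U ⊆ J, U.card ≤ (propsOn n P U).card

/-- `A` is lexicographically smaller than `B` with respect to the order `<_i`:
the `<_i`-least element of the symmetric difference lies in `A`. -/
def LexLt (i : ZMod n) (A B : Finset (ZMod n)) : Prop :=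
  ∃ v, v ∈ A ∧ v ∉ B ∧ ∀ w, ord n i w < ord n i v → (w ∈ A ↔ w ∈ B)

/-- A `+` is placed in the box `(a, b)` of the Le diagram with row labels `I₁`
by the necklace term `Ii`: writing `I₁ \ Ii = {a₁ > ⋯ > a_r}` and
`Ii \ I₁ = {b₁ < ⋯ < b_r}` in the `<₁` order, the plusses are in the boxes
`(a_t, b_t)`. -/
def LePlusAt (I₁ Ii : Finset (ZMod n)) (a b : ZMod n) : Prop :=
  a ∈ I₁ \ Ii ∧ b ∈ Ii \ I₁ ∧
    ((I₁ \ Ii).filter fun x => ord n 1 a < ord n 1 x).card =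
      ((Ii \ I₁).filter fun y => ord n 1 y < ord n 1 b).card

/-- The box `(a, b)` of the Le diagram of the diagram `P` contains a `+`. -/
def LePlus [NeZero n] (P : Finset (Prp n)) (a b : ZMod n) : Prop :=
  ∃ i : ZMod n, LePlusAt n (gnSet n P 1) (gnSet n P i) a b

/-- The number of `+` entries in the Le diagram of the diagram `P`. -/
noncomputable def plusCount [NeZero n] (P : Finset (Prp n)) : ℕ :=
  (Finset.univ.filter fun ab : ZMod n × ZMod n => LePlus n P ab.1 ab.2).card

/-- The length of the row labelled `a` of the Young diagram with row labels `I₁`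
(the boxes of row `a` are indexed by the column labels `b ∉ I₁` with `a <₁ b`). -/
noncomputable def rowLen [NeZero n] (I₁ : Finset (ZMod n)) (a : ZMod n) : ℕ :=
  (Finset.univ.filter fun b => b ∉ I₁ ∧ ord n 1 a < ord n 1 b).card

/-- The entry of the matrix `C(W)` in row `p` and column `q`: the indeterminate
`x_{p,q}` if `q ∈ V(p)`, and `0` otherwise. -/
noncomputable def CW (p : Prp n) (q : ZMod n) : MvPolynomial (Prp n × ZMod n) ℝ :=
  if q ∈ supp n p then MvPolynomial.X (p, q) else 0

/-- The column paired with the row `p` in the minors determined by `I_i^W`. -/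
noncomputable def colOf (P : Finset (Prp n)) (i : ZMod n) (p : Prp n) : ZMod n :=
  (gnAssign n P i p).getD i

/-- `Δ_{I_i}`: the determinant of the `k × k` minor of `C(W)` on the columns
indexed by `I_i^W`, rows and columns paired via the necklace assignment. -/
noncomputable def Delta (P : Finset (Prp n)) (i : ZMod n) :
    MvPolynomial (Prp n × ZMod n) ℝ :=
  Matrix.det (Matrix.of fun p q : ↥P => CW n (p : Prp n) (colOf n P i (q : Prp n)))

/-- `S_i`: the propagators whose contribution changes from `I_{i-1}` to `I_i`. -/
noncomputable def Schanged (P : Finset (Prp n)) (i : ZMod n) : Finset (Prp n) :=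
  P.filter fun p => gnAssign n P (i - 1) p ≠ gnAssign n P i p

/-- `r_i`: the determinant of the minor of `C(W)` with rows indexed by `S_i` and
columns indexed by `I_i(S_i)` (equal to `1` when `S_i = ∅`). -/
noncomputable def rfac (P : Finset (Prp n)) (i : ZMod n) :
    MvPolynomial (Prp n × ZMod n) ℝ :=
  Matrix.det
    (Matrix.of fun p q : ↥(Schanged n P i) => CW n (p : Prp n) (colOf n P i (q : Prp n)))

/-- `R = ∏ᵢ rᵢ`, the polynomial produced by the algorithm. -/
noncomputable def Rpoly [NeZero n] (P : Finset (Prp n)) :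
    MvPolynomial (Prp n × ZMod n) ℝ :=
  ∏ i : ZMod n, rfac n P i

/-- Position of the end of the propagator `p` along the edge `e`: larger values
attach closer to the vertex `e`, i.e. earlier in the counterclockwise ordering
of the ends of propagators along the edge `e`. -/
noncomputable def edgeKey (e : ZMod n) (p : Prp n) : ℕ := ord n e (otherEnd n p e)

/-- The propagators of `P` with an end on the edge `e`. -/
noncomputable def onEdge (P : Finset (Prp n)) (e : ZMod n) : Finset (Prp n) :=
  P.filter fun p => e ∈ p

/-- `p` is the first propagator (`p₁`) on the edge `e` in the counterclockwise
ordering of the propagators with an end on the edge `e`. -/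
def IsCcwFirst (P : Finset (Prp n)) (e : ZMod n) (p : Prp n) : Prop :=
  p ∈ onEdge n P e ∧ ∀ q ∈ onEdge n P e, edgeKey n e q ≤ edgeKey n e p

/-- `p` is the last propagator (`p_r`) on the edge `e` in the counterclockwise
ordering of the propagators with an end on the edge `e`. -/
def IsCcwLast (P : Finset (Prp n)) (e : ZMod n) (p : Prp n) : Prop :=
  p ∈ onEdge n P e ∧ ∀ q ∈ onEdge n P e, edgeKey n e p ≤ edgeKey n e q

/-- `p` and `q` are consecutive, in this order (`p = p_j`, `q = p_{j+1}`), in the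
counterclockwise ordering of the propagators with an end on the edge `e`. -/
def ConsecOnEdge (P : Finset (Prp n)) (e : ZMod n) (p q : Prp n) : Prop :=
  p ∈ onEdge n P e ∧ q ∈ onEdge n P e ∧ edgeKey n e q < edgeKey n e p ∧
    ∀ r ∈ onEdge n P e, ¬ (edgeKey n e q < edgeKey n e r ∧ edgeKey n e r < edgeKey n e p)

/-- The factor `R_e` of the denominator `R(W)` associated to the edge `e`:
`R_e = x_{p₁,e+1} • ∏_{j=1}^{r-1} (x_{p_j,e} x_{p_{j+1},e+1} - x_{p_{j+1},e} x_{p_j,e+1}) • x_{p_r,e}`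
for the counterclockwise ordering `p₁, …, p_r` of the propagators on the edge `e`
(`R_e = 1` if there are none). -/
noncomputable def Redge (P : Finset (Prp n)) (e : ZMod n) :
    MvPolynomial (Prp n × ZMod n) ℝ :=
  (∏ p ∈ (onEdge n P e).filter (IsCcwFirst n P e), MvPolynomial.X (p, e + 1)) *
    (∏ pq ∈ (P ×ˢ P).filter (fun pq => ConsecOnEdge n P e pq.1 pq.2),
      (MvPolynomial.X (pq.1, e) * MvPolynomial.X (pq.2, e + 1) -
        MvPolynomial.X (pq.2, e) * MvPolynomial.X (pq.1, e + 1))) *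
    (∏ p ∈ (onEdge n P e).filter (IsCcwLast n P e), MvPolynomial.X (p, e))

/-- The denominator `R(W) = ∏ₑ R_e` of the integrand `Ω(W)`. -/
noncomputable def RW [NeZero n] (P : Finset (Prp n)) :
    MvPolynomial (Prp n × ZMod n) ℝ :=
  ∏ e : ZMod n, Redge n P e

/-- The relabelling map associated to the removal of the vertex `i` from the
vertex set `ZMod n`: the vertex of `ZMod (n-1)` in position `t` (in the `<₁`
order) is sent to the vertex of `ZMod n` in position `t` if `t` precedes the
position of `i`, and to the vertex in position `t+1` otherwise. -/
noncomputable def liftVert (i : ZMod n) (x : ZMod (n - 1)) : ZMod n :=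
  1 + ((if ord (n - 1) 1 x < ord n 1 i then ord (n - 1) 1 x
        else ord (n - 1) 1 x + 1 : ℕ) : ZMod n)

end WLD
namespace WLD

variable {n : ℕ}

theorem mem_supp_iff {p : Prp n} {v : ZMod n} : v ∈ supp n p ↔ v ∈ p ∨ v - 1 ∈ p := by
  induction p using Sym2.ind with
  | _ x y =>
    simp only [supp, Sym2.lift_mk, Finset.mem_insert, Finset.mem_singleton, Sym2.mem_iff,
      sub_eq_iff_eq_add]
    tauto

theorem mk_otherEnd {p : Prp n} {e : ZMod n} (h : e ∈ p) : s(e, otherEnd n p e) = p := by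
  rw [otherEnd, dif_pos h]
  exact Sym2.other_spec h

theorem otherEnd_mk (e f : ZMod n) : otherEnd n s(e, f) e = f :=
  Sym2.congr_right.1 (mk_otherEnd (Sym2.mem_mk_left e f))

theorem ord_lt [NeZero n] (i x : ZMod n) : ord n i x < n := ZMod.val_lt _

theorem ord_injective [NeZero n] (i : ZMod n) : Function.Injective (ord n i) := by
  intro x y h
  simpa using ZMod.val_injective n h

theorem exists_eq_add_natCast [NeZero n] (i x : ZMod n) : ∃ a < n, x = i + (a : ZMod n) :=
  ⟨(x - i).val, ZMod.val_lt _, by simp⟩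

theorem ord_add_natCast_of_le (i : ZMod n) {a b : ℕ} (hab : a ≤ b) (hb : b < n) :
    ord n (i + a) (i + b) = b - a := by
  have h : (i + b - (i + a) : ZMod n) = ((b - a : ℕ) : ZMod n) := by
    rw [Nat.cast_sub hab]; ring
  rw [ord, h, ZMod.val_cast_of_lt (by omega)]

theorem ord_add_natCast_of_lt (i : ZMod n) {a b : ℕ} (hab : b < a) (ha : a < n) :
    ord n (i + a) (i + b) = n + b - a := by
  have h : (i + b - (i + a) : ZMod n) = ((n + b - a : ℕ) : ZMod n) := by
    rw [Nat.cast_sub (by omega)]; push_cast; simp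
  rw [ord, h, ZMod.val_cast_of_lt (by omega)]

theorem cwKey_of_mem_sub_one {p : Prp n} {v : ZMod n} (h : v - 1 ∈ p) :
    cwKey n v p = n + ord n (v - 1) (otherEnd n p (v - 1)) := if_pos h

theorem cwKey_of_notMem_sub_one {p : Prp n} {v : ZMod n} (h : v - 1 ∉ p) :
    cwKey n v p = ord n v (otherEnd n p v) := if_neg h

theorem cwKey_injOn [NeZero n] (v : ZMod n) : Set.InjOn (cwKey n v) {p | v ∈ supp n p} := by
  intro p hp q hq h
  rw [Set.mem_ofPred_eq, mem_supp_iff] at hp hq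
  by_cases h1 : v - 1 ∈ p <;> by_cases h2 : v - 1 ∈ q
  · rw [cwKey_of_mem_sub_one h1, cwKey_of_mem_sub_one h2] at h
    rw [← mk_otherEnd h1, ← mk_otherEnd h2, ord_injective _ (Nat.add_left_cancel h)]
  · rw [cwKey_of_mem_sub_one h1, cwKey_of_notMem_sub_one h2] at h
    have := ord_lt v (otherEnd n q v)
    omega
  · rw [cwKey_of_notMem_sub_one h1, cwKey_of_mem_sub_one h2] at h
    have := ord_lt v (otherEnd n p v)
    omega
  · rw [cwKey_of_notMem_sub_one h1, cwKey_of_notMem_sub_one h2] at h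
    rw [← mk_otherEnd (hp.resolve_right h1), ← mk_otherEnd (hq.resolve_right h2),
      ord_injective _ h]

theorem pickCW_eq_none_iff {S : Finset (Prp n)} {v : ZMod n} :
    pickCW n S v = none ↔ ∀ p ∈ S, v ∉ supp n p := by
  simp [pickCW, Finset.filter_nonempty_iff]

theorem pickCW_eq_some_iff [NeZero n] {S : Finset (Prp n)} {v : ZMod n} {p : Prp n} :
    pickCW n S v = some p ↔
      p ∈ S ∧ v ∈ supp n p ∧ ∀ q ∈ S, v ∈ supp n q → cwKey n v q ≤ cwKey n v p := by
  by_cases h : (S.filter fun p => v ∈ supp n p).Nonempty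
  · have hs := Classical.choose_spec
      ((S.filter fun p => v ∈ supp n p).exists_max_image (cwKey n v) h)
    rw [pickCW, dif_pos h, Option.some_inj]
    generalize Classical.choose
      ((S.filter fun p => v ∈ supp n p).exists_max_image (cwKey n v) h) = r at hs
    simp only [Finset.mem_filter, and_imp] at hs
    obtain ⟨⟨hr, hrv⟩, hmax⟩ := hs
    constructor
    · rintro rfl
      exact ⟨hr, hrv, hmax⟩
    · rintro ⟨hp, hpv, hpmax⟩
      exact cwKey_injOn v hrv hpv (le_antisymm (hpmax r hr hrv) (hmax p hp hpv))
  · rw [pickCW, dif_neg h]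
    simp only [reduceCtorEq, false_iff]
    rintro ⟨hp, hpv, -⟩
    exact h ⟨p, Finset.mem_filter.2 ⟨hp, hpv⟩⟩

theorem gnRun_succ_of_none {P : Finset (Prp n)} {i : ZMod n} {t : ℕ}
    (h : pickCW n (gnRun n P i t).1 (i + t) = none) : gnRun n P i (t + 1) = gnRun n P i t := by
  rw [gnRun, h]

theorem gnRun_succ_of_some {P : Finset (Prp n)} {i : ZMod n} {t : ℕ} {p : Prp n}
    (h : pickCW n (gnRun n P i t).1 (i + t) = some p) :
    gnRun n P i (t + 1) = ((gnRun n P i t).1.erase p,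
      Function.update (gnRun n P i t).2 p (some (i + (t : ZMod n)))) := by
  rw [gnRun, h]

theorem gnRun_fst_antitone (P : Finset (Prp n)) (i : ZMod n) :
    Antitone fun t => (gnRun n P i t).1 := by
  refine antitone_nat_of_succ_le fun t => ?_
  rcases h : pickCW n (gnRun n P i t).1 (i + t) with _ | p
  · rw [gnRun_succ_of_none h]
  · rw [gnRun_succ_of_some h]
    exact Finset.erase_subset _ _

theorem gnRun_fst_subset (P : Finset (Prp n)) (i : ZMod n) (t : ℕ) : (gnRun n P i t).1 ⊆ P :=
  gnRun_fst_antitone P i (Nat.zero_le t)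

/-- A propagator supported on the vertex `i + t` that survives its visit was beaten there by a
more clockwise one. -/
theorem exists_beating_of_mem_succ [NeZero n] {P : Finset (Prp n)} {i : ZMod n} {t : ℕ} {p : Prp n}
    (hp : p ∈ (gnRun n P i (t + 1)).1) (hv : i + t ∈ supp n p) :
    ∃ q ∈ (gnRun n P i t).1, i + t ∈ supp n q ∧ cwKey n (i + t) p < cwKey n (i + t) q := by
  have hp' : p ∈ (gnRun n P i t).1 := gnRun_fst_antitone P i (Nat.le_succ t) hp
  rcases h : pickCW n (gnRun n P i t).1 (i + t) with _ | q
  · exact absurd hv (pickCW_eq_none_iff.1 h p hp')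
  · obtain ⟨hq, hqv, hmax⟩ := pickCW_eq_some_iff.1 h
    refine ⟨q, hq, hqv, lt_of_le_of_ne (hmax p hp' hv) fun heq => ?_⟩
    rw [gnRun_succ_of_some h] at hp
    exact Finset.ne_of_mem_erase hp (cwKey_injOn _ hv hqv heq)

theorem IsAdmissible.ends_ne {P : Finset (Prp n)} (hadm : IsAdmissible n P) {x y : ZMod n}
    (hp : s(x, y) ∈ P) : x ≠ y ∧ x ≠ y + 1 ∧ y ≠ x + 1 := by
  have h := hadm.dense {s(x, y)} (by simpa using hp) (by simp)
  have h4 : 4 ≤ ({x, x + 1, y, y + 1} : Finset (ZMod n)).card := by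
    simpa [suppSet, supp] using h
  refine ⟨?_, ?_, ?_⟩
  · rintro rfl
    have : ({x, x + 1, x, x + 1} : Finset (ZMod n)) = {x, x + 1} := by
      ext; simp
    rw [this] at h4
    have := Finset.card_le_two (a := x) (b := x + 1)
    omega
  · rintro rfl
    have : ({y + 1, y + 1 + 1, y, y + 1} : Finset (ZMod n)) = {y, y + 1, y + 1 + 1} := by
      ext; simp; tauto
    rw [this] at h4
    have := Finset.card_le_three (a := y) (b := y + 1) (c := y + 1 + 1)
    omega
  · rintro rfl
    have : ({x, x + 1, x + 1, x + 1 + 1} : Finset (ZMod n)) = {x, x + 1, x + 1 + 1} := by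
      ext; simp
    rw [this] at h4
    have := Finset.card_le_three (a := x) (b := x + 1) (c := x + 1 + 1)
    omega

theorem IsAdmissible.gap {P : Finset (Prp n)} (hadm : IsAdmissible n P) {i : ZMod n} {a b : ℕ}
    (hp : s(i + (a : ZMod n), i + (b : ZMod n)) ∈ P) : a ≠ b ∧ a ≠ b + 1 ∧ b ≠ a + 1 := by
  obtain ⟨h1, h2, h3⟩ := hadm.ends_ne hp
  refine ⟨?_, ?_, ?_⟩
  · rintro rfl; exact h1 rfl
  · rintro rfl; exact h2 (by push_cast; ring)
  · rintro rfl; exact h3 (by push_cast; ring)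

/-- Noncrossing, in linear coordinates relative to a starting vertex. -/
theorem IsAdmissible.mem_Icc_of_mem_Ioo {P : Finset (Prp n)} (hadm : IsAdmissible n P) {i : ZMod n}
    {a b c d : ℕ} (hp : s(i + (a : ZMod n), i + (b : ZMod n)) ∈ P)
    (hq : s(i + (c : ZMod n), i + (d : ZMod n)) ∈ P) (hac : a < c) (hcb : c < b) (hb : b < n)
    (hd : d < n) : a ≤ d ∧ d ≤ b := by
  by_contra hcon
  refine hadm.noncross _ hp _ hq ⟨_, _, _, _, rfl, rfl, ?_, ?_, ?_⟩
  · rw [ord_add_natCast_of_le i hac.le (by omega)]; omega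
  · rw [ord_add_natCast_of_le i hac.le (by omega), ord_add_natCast_of_le i (by omega) hb]; omega
  · rw [ord_add_natCast_of_le i (by omega) hb]
    rcases lt_or_ge d a with h | h
    · rw [ord_add_natCast_of_lt i h (by omega)]; omega
    · rw [ord_add_natCast_of_le i h hd]; omega

/-- A propagator is deleted at the latest when the visit reaches the first vertex of the second
of its two edges. -/
theorem notMem_gnRun_succ [NeZero n] {P : Finset (Prp n)} (hadm : IsAdmissible n P) (i : ZMod n)
    (b : ℕ) : b < n → ∀ a < b,
      s(i + (a : ZMod n), i + (b : ZMod n)) ∉ (gnRun n P i (b + 1)).1 := by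
  induction b using Nat.strong_induction_on with
  | _ b ih =>
  intro hb a hab hp
  have hpP := gnRun_fst_subset P i _ hp
  have hgap := hadm.gap hpP
  obtain ⟨q, hq, hqv, hlt⟩ := exists_beating_of_mem_succ hp
    (mem_supp_iff.2 (Or.inl (Sym2.mem_mk_right _ _)))
  have hqP := gnRun_fst_subset P i _ hq
  have hb1 : (i + b - 1 : ZMod n) = i + ((b - 1 : ℕ) : ZMod n) := by
    rw [Nat.cast_sub (by omega)]; push_cast; ring
  by_cases hmem : i + (b : ZMod n) - 1 ∈ q
  · -- `q` ends on the preceding edge, hence should already be gone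
    rw [hb1] at hmem
    obtain ⟨c, hc, hce⟩ := exists_eq_add_natCast i (otherEnd n q (i + ((b - 1 : ℕ) : ZMod n)))
    have hqe := mk_otherEnd hmem
    rw [hce] at hqe
    rw [← hqe] at hqP hq
    have hc' := hadm.mem_Icc_of_mem_Ioo hpP hqP (by omega) (by omega) hb hc
    have hqgap := hadm.gap hqP
    rw [Sym2.eq_swap] at hq
    refine ih (b - 1) (by omega) (by omega) c (by omega) ?_
    rwa [Nat.sub_add_cancel (by omega)]
  · have hqb := (mem_supp_iff.1 hqv).resolve_right hmem
    obtain ⟨c, hc, hce⟩ := exists_eq_add_natCast i (otherEnd n q (i + (b : ZMod n)))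
    have hqe := mk_otherEnd hqb
    have hpn : i + (b : ZMod n) - 1 ∉ s(i + (a : ZMod n), i + (b : ZMod n)) := by
      intro h
      obtain ⟨h1, h2, h3⟩ := hadm.ends_ne hpP
      rcases Sym2.mem_iff.1 h with h | h
      · exact h3 (by rw [← h]; ring)
      · have hz : (1 : ZMod n) = 0 := by
          have := sub_eq_self.1 h
          exact this
        exact h1 (by rw [← mul_one (i + (a : ZMod n)), ← mul_one (i + (b : ZMod n)), hz]; simp)
    rw [cwKey_of_notMem_sub_one hmem, cwKey_of_notMem_sub_one hpn, hce, Sym2.eq_swap, otherEnd_mk,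
      ord_add_natCast_of_lt i hab hb] at hlt
    rw [hce, Sym2.eq_swap] at hqe
    rw [← hqe] at hqP hq
    have hqgap := hadm.gap hqP
    have hcab : a < c ∧ c < b := by
      rcases lt_or_ge c b with h | h
      · rw [ord_add_natCast_of_lt i h hb] at hlt; omega
      · rw [ord_add_natCast_of_le i h hc] at hlt; omega
    -- `q` survived its visit at `c + 1`, so something on the edge `c` beat it there
    have hc1 : (i + ((c + 1 : ℕ) : ZMod n) - 1 : ZMod n) = i + (c : ZMod n) := by
      push_cast; ring
    have hq2 := gnRun_fst_antitone P i (show c + 1 + 1 ≤ b by omega) hq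
    have hqc : i + ((c + 1 : ℕ) : ZMod n) - 1 ∈ s(i + (c : ZMod n), i + (b : ZMod n)) := by
      rw [hc1]; exact Sym2.mem_mk_left _ _
    obtain ⟨r, hr, hrv, hlt'⟩ := exists_beating_of_mem_succ hq2 (mem_supp_iff.2 (Or.inr hqc))
    rw [cwKey_of_mem_sub_one hqc] at hlt'
    have hrc : i + ((c + 1 : ℕ) : ZMod n) - 1 ∈ r := by
      by_contra h
      rw [cwKey_of_notMem_sub_one h] at hlt'
      have := ord_lt (i + ((c + 1 : ℕ) : ZMod n)) (otherEnd n r (i + ((c + 1 : ℕ) : ZMod n)))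
      omega
    rw [cwKey_of_mem_sub_one hrc, hc1, otherEnd_mk] at hlt'
    rw [hc1] at hrc
    obtain ⟨d, hd, hde⟩ := exists_eq_add_natCast i (otherEnd n r (i + (c : ZMod n)))
    have hre := mk_otherEnd hrc
    rw [hde] at hre hlt'
    rw [← hre] at hr
    have hd' := hadm.mem_Icc_of_mem_Ioo hpP (gnRun_fst_subset P i _ hr) hcab.1 hcab.2 hb hd
    rw [ord_add_natCast_of_le i hcab.2.le hb] at hlt'
    rcases lt_or_ge d c with h | h
    · rw [Sym2.eq_swap] at hr
      exact ih c hcab.2 hc d h hr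
    · rw [ord_add_natCast_of_le i h hd] at hlt'
      omega

/-- Every propagator is deleted in the course of a full circuit. -/
theorem gnRun_fst_eq_empty [NeZero n] {P : Finset (Prp n)} (hadm : IsAdmissible n P)
    (i : ZMod n) : (gnRun n P i n).1 = ∅ := by
  refine Finset.eq_empty_of_forall_notMem fun p => ?_
  induction p using Sym2.ind with
  | _ x y =>
    intro hp
    obtain ⟨a, ha, rfl⟩ := exists_eq_add_natCast i x
    obtain ⟨b, hb, rfl⟩ := exists_eq_add_natCast i y
    have hne := (hadm.gap (gnRun_fst_subset P i _ hp)).1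
    rcases lt_or_gt_of_ne hne with h | h
    · exact notMem_gnRun_succ hadm i b hb a h (gnRun_fst_antitone P i hb hp)
    · rw [Sym2.eq_swap] at hp
      exact notMem_gnRun_succ hadm i a ha b h (gnRun_fst_antitone P i ha hp)

/-- The vertices contributed during the first `t` steps of the algorithm. -/
noncomputable def gnPartial [NeZero n] (P : Finset (Prp n)) (i : ZMod n) (t : ℕ) :
    Finset (ZMod n) :=
  Finset.univ.filter fun v => ∃ p, (gnRun n P i t).2 p = some v

theorem mem_gnPartial [NeZero n] {P : Finset (Prp n)} {i v : ZMod n} {t : ℕ} :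
    v ∈ gnPartial P i t ↔ ∃ p, (gnRun n P i t).2 p = some v := by
  simp [gnPartial]

theorem gnPartial_zero [NeZero n] (P : Finset (Prp n)) (i : ZMod n) : gnPartial P i 0 = ∅ := by
  simp [gnPartial, gnRun]

theorem gnRun_snd_eq_none [NeZero n] {P : Finset (Prp n)} {i : ZMod n} {p : Prp n} {t : ℕ}
    (hp : p ∈ (gnRun n P i t).1) : (gnRun n P i t).2 p = none := by
  induction t with
  | zero => rfl
  | succ t ih =>
    rcases h : pickCW n (gnRun n P i t).1 (i + t) with _ | q
    · rw [gnRun_succ_of_none h] at hp ⊢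
      exact ih hp
    · rw [gnRun_succ_of_some h] at hp ⊢
      obtain ⟨hne, hp⟩ := Finset.mem_erase.1 hp
      simpa [Function.update_of_ne hne] using ih hp

theorem gnPartial_succ_of_none [NeZero n] {P : Finset (Prp n)} {i : ZMod n} {t : ℕ}
    (h : pickCW n (gnRun n P i t).1 (i + t) = none) :
    gnPartial P i (t + 1) = gnPartial P i t := by
  rw [gnPartial, gnRun_succ_of_none h, gnPartial]

theorem gnPartial_succ_of_some [NeZero n] {P : Finset (Prp n)} {i : ZMod n} {t : ℕ} {p : Prp n}
    (h : pickCW n (gnRun n P i t).1 (i + t) = some p) :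
    gnPartial P i (t + 1) = insert (i + (t : ZMod n)) (gnPartial P i t) := by
  have hp := gnRun_snd_eq_none (pickCW_eq_some_iff.1 h).1
  ext v
  rw [Finset.mem_insert, mem_gnPartial, mem_gnPartial, gnRun_succ_of_some h]
  constructor
  · rintro ⟨q, hq⟩
    by_cases hqp : q = p
    · subst hqp
      left
      simpa using hq.symm
    · right
      exact ⟨q, by simpa [Function.update_of_ne hqp] using hq⟩
  · rintro (rfl | ⟨q, hq⟩)
    · exact ⟨p, by simp⟩
    · have hqp : q ≠ p := by
        rintro rfl
        simp [hp] at hq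
      exact ⟨q, by simpa [Function.update_of_ne hqp] using hq⟩

theorem exists_of_mem_gnPartial [NeZero n] {P : Finset (Prp n)} {i v : ZMod n} {t : ℕ}
    (hv : v ∈ gnPartial P i t) : ∃ s < t, v = i + (s : ZMod n) := by
  induction t with
  | zero => simp [gnPartial_zero] at hv
  | succ t ih =>
    have key : v = i + (t : ZMod n) ∨ v ∈ gnPartial P i t := by
      rcases h : pickCW n (gnRun n P i t).1 (i + t) with _ | q
      · rw [gnPartial_succ_of_none h] at hv
        exact Or.inr hv
      · rw [gnPartial_succ_of_some h] at hv
        exact Finset.mem_insert.1 hv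
    rcases key with rfl | hv
    · exact ⟨t, by omega, rfl⟩
    · obtain ⟨s, hs, rfl⟩ := ih hv
      exact ⟨s, by omega, rfl⟩

theorem natCast_inj_of_lt {s t : ℕ} (hs : s < n) (ht : t < n)
    (h : (s : ZMod n) = (t : ZMod n)) : s = t := by
  rw [← ZMod.val_cast_of_lt hs, h, ZMod.val_cast_of_lt ht]

theorem card_gnPartial_add_card [NeZero n] (P : Finset (Prp n)) (i : ZMod n) {t : ℕ}
    (ht : t ≤ n) : (gnPartial P i t).card + (gnRun n P i t).1.card = P.card := by
  induction t with
  | zero => simp [gnPartial_zero, gnRun]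
  | succ t ih =>
    have ih := ih (by omega)
    rcases h : pickCW n (gnRun n P i t).1 (i + t) with _ | q
    · rwa [gnPartial_succ_of_none h, gnRun_succ_of_none h]
    · have hq := (pickCW_eq_some_iff.1 h).1
      have hnot : i + (t : ZMod n) ∉ gnPartial P i t := by
        intro hmem
        obtain ⟨s, hs, he⟩ := exists_of_mem_gnPartial hmem
        have := natCast_inj_of_lt (by omega) (by omega) (add_left_cancel he)
        omega
      rw [gnPartial_succ_of_some h, gnRun_succ_of_some h, Finset.card_insert_of_notMem hnot,
        Finset.card_erase_of_mem hq]
      have := Finset.card_pos.2 ⟨q, hq⟩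
      omega

/-- The run from `i` and the run from `i + 1`, both about to visit `i + 1 + t`, when no propagator
is supported on `i`. -/
theorem gnRun_succ_eq_of_pickCW_eq_none [NeZero n] {P : Finset (Prp n)} {i : ZMod n}
    (h0 : pickCW n P i = none) (t : ℕ) :
    (gnRun n P (i + 1) t).1 = (gnRun n P i (t + 1)).1 ∧
      gnPartial P (i + 1) t = gnPartial P i (t + 1) := by
  induction t with
  | zero =>
    have h : pickCW n (gnRun n P i 0).1 (i + (0 : ℕ)) = none := by simpa [gnRun] using h0
    rw [gnRun_succ_of_none h, gnPartial_succ_of_none h, gnPartial_zero, gnPartial_zero]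
    exact ⟨rfl, rfl⟩
  | succ t ih =>
    obtain ⟨hS, hV⟩ := ih
    have hv : i + 1 + (t : ZMod n) = i + ((t + 1 : ℕ) : ZMod n) := by push_cast; ring
    rcases h : pickCW n (gnRun n P i (t + 1)).1 (i + ((t + 1 : ℕ) : ZMod n)) with _ | q
    · have h' := h
      rw [← hS, ← hv] at h'
      rw [gnRun_succ_of_none h, gnRun_succ_of_none h', gnPartial_succ_of_none h,
        gnPartial_succ_of_none h']
      exact ⟨hS, hV⟩
    · have h' := h
      rw [← hS, ← hv] at h'
      rw [gnRun_succ_of_some h, gnRun_succ_of_some h', gnPartial_succ_of_some h,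
        gnPartial_succ_of_some h', hS, hV, hv]
      exact ⟨rfl, rfl⟩

/-- The run from `i` and the run from `i + 1`, both about to visit `i + 1 + t`, when some
propagator is supported on `i`: the second run lags behind by one propagator until it catches up
by contributing an additional vertex `j`. -/
theorem gnRun_lag [NeZero n] {P : Finset (Prp n)} {i : ZMod n} {p : Prp n}
    (h0 : pickCW n P i = some p) {t : ℕ} (ht : t < n) :
    (∃ q ∉ (gnRun n P i (t + 1)).1,
      (gnRun n P (i + 1) t).1 = insert q (gnRun n P i (t + 1)).1 ∧
        gnPartial P (i + 1) t = (gnPartial P i (t + 1)).erase i) ∨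
    ((gnRun n P (i + 1) t).1 = (gnRun n P i (t + 1)).1 ∧
      ∃ j, gnPartial P (i + 1) t = insert j ((gnPartial P i (t + 1)).erase i)) := by
  induction t with
  | zero =>
    have h : pickCW n (gnRun n P i 0).1 (i + (0 : ℕ)) = some p := by simpa [gnRun] using h0
    have hp := (pickCW_eq_some_iff.1 h0).1
    left
    refine ⟨p, ?_, ?_, ?_⟩
    · rw [gnRun_succ_of_some h]
      exact Finset.notMem_erase _ _
    · rw [gnRun_succ_of_some h]
      exact (Finset.insert_erase hp).symm
    · rw [gnPartial_succ_of_some h, gnPartial_zero, gnPartial_zero]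
      simp
  | succ t ih =>
    have hv : i + 1 + (t : ZMod n) = i + ((t + 1 : ℕ) : ZMod n) := by push_cast; ring
    have hne : i ≠ i + ((t + 1 : ℕ) : ZMod n) := by
      intro h
      have h' : ((0 : ℕ) : ZMod n) = ((t + 1 : ℕ) : ZMod n) := by
        rw [Nat.cast_zero]
        exact (left_eq_add.1 h).symm
      have := natCast_inj_of_lt (by omega) ht h'
      omega
    rcases ih (by omega) with ⟨q, hq, hS, hV⟩ | ⟨hS, j, hV⟩
    · rcases hB : pickCW n (gnRun n P (i + 1) t).1 (i + 1 + t) with _ | r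
      · have hA : pickCW n (gnRun n P i (t + 1)).1 (i + ((t + 1 : ℕ) : ZMod n)) = none := by
          rw [pickCW_eq_none_iff, hS, hv] at hB
          rw [pickCW_eq_none_iff]
          exact fun r hr => hB r (Finset.mem_insert_of_mem hr)
        left
        refine ⟨q, ?_, ?_, ?_⟩
        · rwa [gnRun_succ_of_none hA]
        · rwa [gnRun_succ_of_none hA, gnRun_succ_of_none hB]
        · rwa [gnPartial_succ_of_none hA, gnPartial_succ_of_none hB]
      · have hB' := pickCW_eq_some_iff.1 hB
        rw [hS, hv] at hB'
        obtain ⟨hr, hrv, hmax⟩ := hB'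
        by_cases hrq : r = q
        · subst hrq
          rcases hA : pickCW n (gnRun n P i (t + 1)).1 (i + ((t + 1 : ℕ) : ZMod n)) with _ | s
          · right
            refine ⟨?_, i + ((t + 1 : ℕ) : ZMod n), ?_⟩
            · rw [gnRun_succ_of_none hA, gnRun_succ_of_some hB]
              simp only [hS, Finset.erase_insert hq]
            · rw [gnPartial_succ_of_none hA, gnPartial_succ_of_some hB, hV, hv]
          · have hs := (pickCW_eq_some_iff.1 hA).1
            left
            refine ⟨s, ?_, ?_, ?_⟩
            · rw [gnRun_succ_of_some hA]
              exact Finset.notMem_erase _ _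
            · rw [gnRun_succ_of_some hA, gnRun_succ_of_some hB]
              simp only [hS, Finset.erase_insert hq, Finset.insert_erase hs]
            · rw [gnPartial_succ_of_some hA, gnPartial_succ_of_some hB, hV, hv,
                Finset.erase_insert_of_ne hne.symm]
        · have hA : pickCW n (gnRun n P i (t + 1)).1 (i + ((t + 1 : ℕ) : ZMod n)) = some r :=
            pickCW_eq_some_iff.2 ⟨Finset.mem_of_mem_insert_of_ne hr hrq, hrv,
              fun s hs => hmax s (Finset.mem_insert_of_mem hs)⟩
          left
          refine ⟨q, ?_, ?_, ?_⟩
          · rw [gnRun_succ_of_some hA]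
            exact fun h => hq (Finset.mem_of_mem_erase h)
          · rw [gnRun_succ_of_some hA, gnRun_succ_of_some hB]
            simp only [hS]
            exact Finset.erase_insert_of_ne (Ne.symm hrq)
          · rw [gnPartial_succ_of_some hA, gnPartial_succ_of_some hB, hV, hv,
              Finset.erase_insert_of_ne hne.symm]
    · right
      rcases hA : pickCW n (gnRun n P i (t + 1)).1 (i + ((t + 1 : ℕ) : ZMod n)) with _ | r
      · have hB := hA
        rw [← hS, ← hv] at hB
        rw [gnRun_succ_of_none hA, gnRun_succ_of_none hB, gnPartial_succ_of_none hA,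
          gnPartial_succ_of_none hB]
        exact ⟨hS, j, hV⟩
      · have hB := hA
        rw [← hS, ← hv] at hB
        rw [gnRun_succ_of_some hA, gnRun_succ_of_some hB, gnPartial_succ_of_some hA,
          gnPartial_succ_of_some hB, hV, hv]
        refine ⟨by simp only [hS], j, ?_⟩
        rw [Finset.erase_insert_of_ne hne.symm, Finset.insert_comm]

theorem gnPartial_mono [NeZero n] (P : Finset (Prp n)) (i : ZMod n) :
    Monotone (gnPartial P i) := by
  refine monotone_nat_of_le_succ fun t => ?_
  rcases h : pickCW n (gnRun n P i t).1 (i + t) with _ | q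
  · rw [gnPartial_succ_of_none h]
  · rw [gnPartial_succ_of_some h]
    exact Finset.subset_insert _ _

theorem self_mem_gnPartial [NeZero n] {P : Finset (Prp n)} {i : ZMod n} {p : Prp n}
    (h0 : pickCW n P i = some p) {t : ℕ} (ht : 0 < t) : i ∈ gnPartial P i t := by
  have h : pickCW n (gnRun n P i 0).1 (i + (0 : ℕ)) = some p := by simpa [gnRun] using h0
  refine gnPartial_mono P i (show 0 + 1 ≤ t from ht) ?_
  rw [gnPartial_succ_of_some h]
  simp

/-- the algorithm produces a Grassmann necklace.
Let `W` be an admissible Wilson loop diagram with `k` propagators and `n`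
vertices.  The sequence of `k`-subsets `(I_1^W, …, I_n^W)` obtained by applying
the Grassmann necklace algorithm at every starting vertex of `W` is a Grassmann
necklace of type `(k, n)`. -/
theorem gnSet_isGrassmannNecklace
    (n : ℕ) [NeZero n] (P : Finset (Prp n)) (hadm : IsAdmissible n P) :
    IsGrassmannNecklace n P.card (fun i => gnSet n P i) := by
  have hset : ∀ i, gnSet n P i = gnPartial P i n := fun _ => rfl
  obtain ⟨m, hm⟩ := Nat.exists_eq_succ_of_ne_zero (NeZero.ne n)
  have hm' : m + 1 = n := hm.symm
  have hlast : ∀ i : ZMod n, i + 1 + (m : ZMod n) = i := fun i => by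
    have : ((m + 1 : ℕ) : ZMod n) = 0 := by rw [hm']; exact ZMod.natCast_self n
    push_cast at this
    linear_combination this
  refine ⟨fun i => ?_, fun i => ?_⟩
  · have h := card_gnPartial_add_card P i le_rfl
    rwa [gnRun_fst_eq_empty hadm, Finset.card_empty, add_zero] at h
  · simp only [hset]
    have hA := gnRun_fst_eq_empty hadm i
    have hB := gnRun_fst_eq_empty hadm (i + 1)
    have caught_up : (gnRun n P (i + 1) m).1 = ∅ →
        gnPartial P (i + 1) n = gnPartial P (i + 1) m := fun h => by
      have hnone := gnPartial_succ_of_none (P := P) (i := i + 1) (t := m)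
        (pickCW_eq_none_iff.2 (by simp [h]))
      rwa [hm'] at hnone
    rcases h0 : pickCW n P i with _ | p
    · obtain ⟨hS, hV⟩ := gnRun_succ_eq_of_pickCW_eq_none h0 m
      rw [hm', hA] at hS
      rw [hm'] at hV
      have heq : gnPartial P (i + 1) n = gnPartial P i n := (caught_up hS).trans hV
      exact ⟨fun hi => ⟨i, by rw [heq, Finset.insert_erase hi]⟩, fun _ => heq⟩
    · have hi := self_mem_gnPartial h0 (NeZero.pos n)
      refine ⟨fun _ => ?_, fun h => absurd hi h⟩
      have hlag := gnRun_lag h0 (t := m) (by omega)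
      rw [hm', hA] at hlag
      rcases hlag with ⟨q, -, hS, hV⟩ | ⟨hS, j, hV⟩
      · rcases hp : pickCW n (gnRun n P (i + 1) m).1 (i + 1 + m) with _ | r
        · have h := gnRun_succ_of_none hp
          rw [hm'] at h
          rw [h, hS] at hB
          exact absurd hB (Finset.insert_ne_empty _ _)
        · have h := gnPartial_succ_of_some hp
          rw [hm', hV, hlast] at h
          exact ⟨i, h⟩
      · exact ⟨j, (caught_up hS).trans hV⟩

end WLD
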